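/- arXiv:2604.05962 — 4 statements merged into one kernel-verified Lean document; each statement's English description precedes it below -/
import Mathlib

section
/- Let Θ be a finite probability space, let m ≥ 1 and d ≥ 1, and for each i ∈ [m] let σ_i ∈ ℂ^{d×d} be a positive definite density matrix and, for each θ ∈ Θ, let σ_{i,θ} ∈ ℂ^{d×d} be a density matrix. For θ, θ′ ∈ Θ define Z_i(θ,θ′) = tr( σ_i⁻¹ (σ_{i,θ} − σ_i)(σ_{i,θ′} − σ_i) ). Then D_{χ²}( E_θ[ ⊗_{i=1}^m σ_{i,θ} ] ‖ ⊗_{i=1}^m σ_i ) = E_{θ,θ′}[ ∏_{i=1}^m (1 + Z_i(θ,θ′)) ] − 1 ≤ E_{θ,θ′}[ ∏_{i=1}^m exp(Z_i(θ,θ′)) ], where θ, θ′ are drawn independently from the distribution on Θ. -/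
open Matrix ComplexOrder

/-- The `m`-fold Kronecker (tensor) product `⊗_{i=1}^m M_i` of a family of `d×d` matrices,
realized on the index type `Fin m → Fin d`. -/
noncomputable def kronFam (m d : ℕ) (M : Fin m → Matrix (Fin d) (Fin d) ℂ) :
    Matrix (Fin m → Fin d) (Fin m → Fin d) ℂ :=
  Matrix.of fun x y => ∏ i, M i (x i) (y i)

section KronFam

variable {m d : ℕ}

theorem kronFam_mul (A B : Fin m → Matrix (Fin d) (Fin d) ℂ) :
    kronFam m d A * kronFam m d B = kronFam m d (fun i => A i * B i) := by
  ext x y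
  simp only [kronFam, Matrix.mul_apply, Matrix.of_apply, ← Finset.prod_mul_distrib]
  rw [Finset.prod_univ_sum, Fintype.piFinset_univ]

theorem kronFam_one : kronFam m d (fun _ => 1) = 1 := by
  ext x y
  simp only [kronFam, Matrix.of_apply, Matrix.one_apply, Finset.prod_ite_zero,
    Finset.prod_const_one, funext_iff, Finset.mem_univ, true_implies]

theorem trace_kronFam (A : Fin m → Matrix (Fin d) (Fin d) ℂ) :
    (kronFam m d A).trace = ∏ i, (A i).trace := by
  simp only [kronFam, Matrix.trace, Matrix.diag_apply, Matrix.of_apply]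
  rw [Finset.prod_univ_sum, Fintype.piFinset_univ]

theorem kronFam_inv (A : Fin m → Matrix (Fin d) (Fin d) ℂ) (hA : ∀ i, IsUnit (A i)) :
    (kronFam m d A)⁻¹ = kronFam m d (fun i => (A i)⁻¹) := by
  refine Matrix.inv_eq_right_inv ?_
  rw [kronFam_mul, ← kronFam_one]
  congr 1
  funext i
  exact Matrix.mul_nonsing_inv _ ((Matrix.isUnit_iff_isUnit_det _).1 (hA i))

end KronFam

section Kernels

variable {ι n : Type*} [Fintype ι] [Fintype n]

theorem posSemidef_trace_mul_mul {S : Matrix n n ℂ} (hS : S.PosSemidef)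
    (A : ι → Matrix n n ℂ) (hA : ∀ i, (A i).IsHermitian) :
    (Matrix.of fun i j => (S * A i * A j).trace).PosSemidef := by
  refine PosSemidef.of_dotProduct_mulVec_nonneg ?_ fun x => ?_
  · ext i j
    rw [conjTranspose_apply, of_apply, of_apply, ← trace_conjTranspose, conjTranspose_mul,
      conjTranspose_mul, (hA i).eq, (hA j).eq, hS.isHermitian.eq, ← Matrix.mul_assoc,
      trace_mul_comm, Matrix.mul_assoc]
  · have key : star x ⬝ᵥ ((Matrix.of fun i j => (S * A i * A j).trace) *ᵥ x)
        = ((∑ i, x i • A i) * S * (∑ i, x i • A i)ᴴ).trace := by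
      rw [trace_mul_comm, ← Matrix.mul_assoc, trace_mul_comm, ← Matrix.mul_assoc]
      simp only [conjTranspose_sum, conjTranspose_smul, (hA _).eq, dotProduct, mulVec, of_apply,
        Matrix.sum_mul, trace_sum, Finset.mul_sum, Matrix.mul_smul,
        Matrix.smul_mul, trace_smul, Pi.star_apply, smul_eq_mul]
      rw [Finset.sum_comm]
      refine Finset.sum_congr rfl fun i _ => Finset.sum_congr rfl fun j _ => ?_
      ring
    rw [key]
    exact (hS.mul_mul_conjTranspose_same _).trace_nonneg

theorem posSemidef_of_one : (Matrix.of fun _ _ : ι => (1 : ℂ)).PosSemidef := by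
  convert posSemidef_vecMulVec_self_star (1 : ι → ℂ) using 1
  ext i j
  simp [vecMulVec_apply]

omit [Fintype ι] in
theorem posSemidef_hadamard {A B : Matrix ι ι ℂ} (hA : A.PosSemidef) (hB : B.PosSemidef) :
    (A ⊙ B).PosSemidef :=
  hA.hadamard hB

theorem posSemidef_of_pow {M : Matrix ι ι ℂ} (hM : M.PosSemidef) (k : ℕ) :
    (Matrix.of fun i j => M i j ^ k).PosSemidef := by
  induction k with
  | zero => simpa using posSemidef_of_one
  | succ k ih =>
    convert posSemidef_hadamard ih hM using 1
    ext i j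
    simp [pow_succ]

theorem isClosed_posSemidef : IsClosed {M : Matrix ι ι ℂ | M.PosSemidef} := by
  simp only [posSemidef_iff_dotProduct_mulVec, Set.ofPred_and, Set.ofPred_forall]
  refine (isClosed_eq (by fun_prop) continuous_id).inter (isClosed_iInter fun x => ?_)
  exact isClosed_le continuous_const (by fun_prop)

theorem posSemidef_exp_sub_one_add {M : Matrix ι ι ℂ} (hM : M.PosSemidef) :
    (Matrix.of fun i j => Complex.exp (M i j) - (1 + M i j)).PosSemidef := by
  have hsum : HasSum (fun k : ℕ => Matrix.of fun i j => M i j ^ (k + 2) / ((k + 2).factorial : ℂ))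
      (Matrix.of fun i j => Complex.exp (M i j) - (1 + M i j)) := by
    refine Pi.hasSum.2 fun i => Pi.hasSum.2 fun j => ?_
    have h := NormedSpace.expSeries_div_hasSum_exp (M i j)
    rw [← Complex.exp_eq_exp_ℂ] at h
    have h' := (hasSum_nat_add_iff' 2).2 h
    simpa [Finset.sum_range_succ] using h'
  refine isClosed_posSemidef.mem_of_tendsto hsum (Filter.Eventually.of_forall fun s => ?_)
  refine posSemidef_sum s fun k _ => ?_
  have hk : (0 : ℂ) ≤ ((k + 2).factorial : ℂ)⁻¹ := by positivity
  convert (posSemidef_of_pow hM (k + 2)).smul hk using 1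
  ext i j
  simp [div_eq_inv_mul]

theorem posSemidef_prod_exp_sub_prod {κ : Type*} (s : Finset κ) {M : κ → Matrix ι ι ℂ}
    (hM : ∀ k, (M k).PosSemidef) :
    (Matrix.of fun i j => ∏ k ∈ s, (1 + M k i j)).PosSemidef ∧
      (Matrix.of fun i j =>
        ∏ k ∈ s, Complex.exp (M k i j) - ∏ k ∈ s, (1 + M k i j)).PosSemidef := by
  classical
  induction s using Finset.induction_on with
  | empty =>
    refine ⟨by simpa using posSemidef_of_one, ?_⟩
    convert PosSemidef.zero using 1
    ext i j
    simp
  | insert k s hk ih =>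
    obtain ⟨hP, hD⟩ := ih
    have h1 := posSemidef_of_one.add (hM k)
    refine ⟨?_, ?_⟩
    · convert posSemidef_hadamard h1 hP using 1
      ext i j
      simp [Finset.prod_insert hk]
    · convert (posSemidef_hadamard h1 hD).add
        (posSemidef_hadamard (posSemidef_exp_sub_one_add (hM k)) (hD.add hP)) using 1
      ext i j
      simp [Finset.prod_insert hk]
      ring

end Kernels

theorem trace_inv_mul_sub_mul_sub {n : Type*} [Fintype n] [DecidableEq n] {S A B : Matrix n n ℂ}
    (hS : IsUnit S) (hA : A.trace = S.trace) :
    (S⁻¹ * (A - S) * (B - S)).trace = (S⁻¹ * A * B).trace - B.trace := by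
  have hdet := (Matrix.isUnit_iff_isUnit_det _).1 hS
  have h : (S⁻¹ * A * S).trace = A.trace := by
    rw [trace_mul_comm, ← Matrix.mul_assoc, Matrix.mul_nonsing_inv _ hdet, Matrix.one_mul]
  simp only [Matrix.mul_sub, Matrix.sub_mul, trace_sub, Matrix.nonsing_inv_mul _ hdet,
    Matrix.one_mul, h, hA]
  ring

/-- Quantum Ingster–Suslina method: for a finite probability space `Θ`, positive definite
density matrices `σ_i` and density matrices `σ_{i,θ}`, setting
`Z_i(θ,θ′) = tr(σ_i⁻¹(σ_{i,θ} − σ_i)(σ_{i,θ′} − σ_i))`, the quantum χ²-divergence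
`D_{χ²}(E_θ[⊗_i σ_{i,θ}] ‖ ⊗_i σ_i) = tr((⊗_i σ_i)⁻¹ (E_θ[⊗_i σ_{i,θ}])²) − 1` equals
`E_{θ,θ′}[∏_i (1 + Z_i(θ,θ′))] − 1` and is at most `E_{θ,θ′}[∏_i exp(Z_i(θ,θ′))]`
(the last inequality read on real parts). -/
theorem stmt6 (Θ : Type) [Fintype Θ] (p : Θ → ℝ) (hp : ∀ θ, 0 ≤ p θ) (hp1 : ∑ θ, p θ = 1)
    (m d : ℕ) (hm : 1 ≤ m) (hd : 1 ≤ d)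
    (σ : Fin m → Matrix (Fin d) (Fin d) ℂ)
    (hσpd : ∀ i, (σ i).PosDef) (hσtr : ∀ i, (σ i).trace = 1)
    (σθ : Fin m → Θ → Matrix (Fin d) (Fin d) ℂ)
    (hσθ : ∀ i θ, (σθ i θ).PosSemidef) (hσθtr : ∀ i θ, (σθ i θ).trace = 1) :
    let Z : Θ → Θ → Fin m → ℂ := fun θ θ' i =>
      ((σ i)⁻¹ * (σθ i θ - σ i) * (σθ i θ' - σ i)).trace
    let ρbar : Matrix (Fin m → Fin d) (Fin m → Fin d) ℂ :=
      ∑ θ, (p θ : ℂ) • kronFam m d (fun i => σθ i θ)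
    let σm : Matrix (Fin m → Fin d) (Fin m → Fin d) ℂ := kronFam m d σ
    ((σm⁻¹ * ρbar * ρbar).trace - 1
        = (∑ θ, ∑ θ', ((p θ : ℂ) * (p θ' : ℂ)) * ∏ i, (1 + Z θ θ' i)) - 1)
    ∧ ((∑ θ, ∑ θ', ((p θ : ℂ) * (p θ' : ℂ)) * ∏ i, (1 + Z θ θ' i)) - 1).re
        ≤ (∑ θ, ∑ θ', ((p θ : ℂ) * (p θ' : ℂ)) * ∏ i, Complex.exp (Z θ θ' i)).re := by
  intro Z ρbar σm
  have hu : ∀ i, IsUnit (σ i) := fun i => (hσpd i).isUnit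
  have hZ : ∀ θ θ' i, 1 + Z θ θ' i = ((σ i)⁻¹ * σθ i θ * σθ i θ').trace := fun θ θ' i => by
    simp only [Z]
    rw [trace_inv_mul_sub_mul_sub (hu i) (by rw [hσθtr, hσtr]), hσθtr]
    ring
  have hpsd : ∀ i, (Matrix.of fun θ θ' => Z θ θ' i).PosSemidef := fun i =>
    posSemidef_trace_mul_mul (hσpd i).posSemidef.inv (fun θ => σθ i θ - σ i)
      fun θ => (hσθ i θ).isHermitian.sub (hσpd i).isHermitian
  refine ⟨?_, ?_⟩
  · simp only [σm, ρbar, kronFam_inv σ hu, hZ, Matrix.sum_mul, Matrix.mul_smul,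
      Matrix.smul_mul, trace_sum, trace_smul, kronFam_mul, trace_kronFam, smul_eq_mul,
      Finset.mul_sum]
    rw [Finset.sum_comm]
    congr 1
    refine Finset.sum_congr rfl fun θ _ => Finset.sum_congr rfl fun θ' _ => ?_
    ring
  · have h := (posSemidef_prod_exp_sub_prod Finset.univ hpsd).2.dotProduct_mulVec_nonneg
      fun θ => (p θ : ℂ)
    have hre := (Complex.le_def.1 h).1
    have key : (star fun θ => (p θ : ℂ)) ⬝ᵥ ((Matrix.of fun θ θ' =>
        ∏ i, Complex.exp (Z θ θ' i) - ∏ i, (1 + Z θ θ' i)) *ᵥ fun θ => (p θ : ℂ))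
        = (∑ θ, ∑ θ', ((p θ : ℂ) * (p θ' : ℂ)) * ∏ i, Complex.exp (Z θ θ' i))
          - ∑ θ, ∑ θ', ((p θ : ℂ) * (p θ' : ℂ)) * ∏ i, (1 + Z θ θ' i) := by
      simp only [dotProduct, mulVec, of_apply, ← Finset.sum_sub_distrib, Finset.mul_sum,
        Pi.star_apply, Complex.star_def, Complex.conj_ofReal]
      refine Finset.sum_congr rfl fun θ _ => Finset.sum_congr rfl fun θ' _ => ?_
      ring
    simp only [of_apply] at hre
    rw [key] at hre
    simp only [Complex.zero_re, Complex.sub_re, Complex.one_re] at hre ⊢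
    linarith
end

section
/- Let d ≥ d_q ≥ 1, and let J be a positive semidefinite Hermitian matrix with rows and columns indexed by pairs (a,b), a ∈ [d], b ∈ [d_q], such that the partial trace of J over the second (d_q-dimensional) factor equals the identity I_d, i.e., ∑_{b∈[d_q]} J_{(a,b),(a′,b)} = δ_{a,a′} for all a, a′ ∈ [d]. Then the operator norm of J satisfies ‖J‖_∞ ≤ d_q, and consequently tr(J²) ≤ d·d_q. -/
open Matrix ComplexOrder

/-- The vector `y ⊗ e_b`. -/
noncomputable def sliceVec {d q : ℕ} (b : Fin q) (y : Fin d → ℂ) :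
    EuclideanSpace ℂ (Fin d × Fin q) :=
  WithLp.toLp 2 fun p => if p.2 = b then y p.1 else 0

theorem sum_sliceVec {d q : ℕ} (x : EuclideanSpace ℂ (Fin d × Fin q)) :
    ∑ b, sliceVec b (fun a => x (a, b)) = x := by
  ext ⟨a, b⟩
  simp [sliceVec]

theorem norm_sq_toEuclideanCLM_apply {n : Type*} [Fintype n] [DecidableEq n]
    (B : Matrix n n ℂ) (v : EuclideanSpace ℂ n) :
    ((‖toEuclideanCLM (𝕜 := ℂ) B v‖ ^ 2 : ℝ) : ℂ) =
      ∑ i, ∑ j, star (v i) * (Bᴴ * B) i j * v j := by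
  have h : ((‖toEuclideanCLM (𝕜 := ℂ) B v‖ ^ 2 : ℝ) : ℂ) =
      inner ℂ v (toEuclideanCLM (𝕜 := ℂ) (Bᴴ * B) v) := by
    rw [← star_eq_conjTranspose, map_mul, map_star, ContinuousLinearMap.star_eq_adjoint,
      mul_apply_eq_comp, ContinuousLinearMap.adjoint_inner_right,
      inner_self_eq_norm_sq_to_K]
    push_cast
    rfl
  rw [h, PiLp.inner_apply]
  refine Finset.sum_congr rfl fun i _ => ?_
  simp only [RCLike.inner_apply, ofLp_toEuclideanCLM, mulVec, dotProduct, Finset.sum_mul]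
  refine Finset.sum_congr rfl fun j _ => ?_
  simp only [RCLike.star_def]
  ring

theorem sum_norm_sq_apply_sliceVec {d q : ℕ} (B : Matrix (Fin d × Fin q) (Fin d × Fin q) ℂ)
    (hptr : ∀ a a' : Fin d, ∑ b, (Bᴴ * B) (a, b) (a', b) = if a = a' then 1 else 0)
    (y : Fin d → ℂ) :
    ∑ b, ‖toEuclideanCLM (𝕜 := ℂ) B (sliceVec b y)‖ ^ 2 = ∑ a, ‖y a‖ ^ 2 := by
  have h : ∀ b, ((‖toEuclideanCLM (𝕜 := ℂ) B (sliceVec b y)‖ ^ 2 : ℝ) : ℂ) =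
      ∑ a, ∑ a', star (y a) * (Bᴴ * B) (a, b) (a', b) * y a' := by
    intro b
    rw [norm_sq_toEuclideanCLM_apply]
    generalize Bᴴ * B = M
    simp [sliceVec, Fintype.sum_prod_type, apply_ite, ite_mul]
  apply Complex.ofReal_injective
  rw [Complex.ofReal_sum, Finset.sum_congr rfl fun b _ => h b, Finset.sum_comm]
  push_cast
  refine Finset.sum_congr rfl fun a _ => ?_
  rw [Finset.sum_comm]
  simp_rw [← Finset.sum_mul, ← Finset.mul_sum, hptr]
  simp [Complex.conj_mul']

theorem norm_sq_toEuclideanCLM_le {d q : ℕ} (B : Matrix (Fin d × Fin q) (Fin d × Fin q) ℂ)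
    (hptr : ∀ a a' : Fin d, ∑ b, (Bᴴ * B) (a, b) (a', b) = if a = a' then 1 else 0) :
    ‖toEuclideanCLM (𝕜 := ℂ) B‖ ^ 2 ≤ q := by
  rw [← Real.le_sqrt (norm_nonneg _) (Nat.cast_nonneg _)]
  refine ContinuousLinearMap.opNorm_le_bound _ (Real.sqrt_nonneg _) fun x => ?_
  refine (sq_le_sq₀ (norm_nonneg _) (by positivity)).mp ?_
  rw [mul_pow, Real.sq_sqrt (Nat.cast_nonneg _)]
  set T := toEuclideanCLM (𝕜 := ℂ) B
  let v : Fin q → EuclideanSpace ℂ (Fin d × Fin q) := fun b => sliceVec b fun a => x (a, b)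
  calc ‖T x‖ ^ 2 = ‖∑ b, T (v b)‖ ^ 2 := by rw [← map_sum, sum_sliceVec]
    _ ≤ (∑ b, ‖T (v b)‖) ^ 2 := by gcongr; exact norm_sum_le _ _
    _ ≤ q * ∑ b, ‖T (v b)‖ ^ 2 := by
      simpa using sq_sum_le_card_mul_sum_sq (s := Finset.univ) (f := fun b => ‖T (v b)‖)
    _ ≤ q * ∑ b, ∑ a, ‖x (a, b)‖ ^ 2 := by
      gcongr with b
      rw [← sum_norm_sq_apply_sliceVec B hptr]
      exact Finset.single_le_sum
        (f := fun c => ‖T (sliceVec c fun a => x (a, b))‖ ^ 2)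
        (fun _ _ => by positivity) (Finset.mem_univ b)
    _ = q * ‖x‖ ^ 2 := by
      rw [EuclideanSpace.norm_sq_eq, Fintype.sum_prod_type_right]

theorem norm_sq_apply_single {n : Type*} [Fintype n] [DecidableEq n]
    (B : Matrix n n ℂ) (i : n) :
    ‖toEuclideanCLM (𝕜 := ℂ) B (EuclideanSpace.single i 1)‖ ^ 2 = ((Bᴴ * B) i i).re := by
  have h := norm_sq_toEuclideanCLM_apply B (EuclideanSpace.single i 1)
  generalize Bᴴ * B = M at *
  have h' := congrArg Complex.re h
  rw [Complex.ofReal_re] at h'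
  rw [h']
  simp [apply_ite, ite_mul]

open scoped MatrixOrder Matrix.Norms.L2Operator in
theorem Matrix.PosSemidef.exists_eq_conjTranspose_mul_self {n : Type*} [Fintype n]
    [DecidableEq n] {A : Matrix n n ℂ} (hA : A.PosSemidef) : ∃ B : Matrix n n ℂ, A = Bᴴ * B :=
  CStarAlgebra.nonneg_iff_eq_star_mul_self.mp hA.nonneg

/-- Choi-operator bound: if `J` is positive semidefinite on `ℂ^d ⊗ ℂ^{d_q}` with partial trace
over the second factor equal to `I_d`, then `‖J‖_∞ ≤ d_q` and `tr(J²) ≤ d·d_q`. -/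
theorem stmt7 (d dq : ℕ) (hdq : 1 ≤ dq) (hd : dq ≤ d)
    (J : Matrix (Fin d × Fin dq) (Fin d × Fin dq) ℂ) (hJ : J.PosSemidef)
    (hptr : ∀ a a' : Fin d, ∑ b, J (a, b) (a', b) = if a = a' then 1 else 0) :
    ‖Matrix.toEuclideanCLM (𝕜 := ℂ) J‖ ≤ (dq : ℝ) ∧ (J * J).trace.re ≤ (d : ℝ) * dq := by
  obtain ⟨B, rfl⟩ := hJ.exists_eq_conjTranspose_mul_self
  have hB := norm_sq_toEuclideanCLM_le B hptr
  have hJB : toEuclideanCLM (𝕜 := ℂ) (Bᴴ * B) =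
      star (toEuclideanCLM (𝕜 := ℂ) B) * toEuclideanCLM (𝕜 := ℂ) B := by
    rw [← star_eq_conjTranspose, map_mul, map_star]
  have htr : ∑ i, ((Bᴴ * B) i i).re = d := by
    rw [← Complex.re_sum, Fintype.sum_prod_type]
    simp [hptr]
  have hnorm : ‖star (toEuclideanCLM (𝕜 := ℂ) B)‖ = ‖toEuclideanCLM (𝕜 := ℂ) B‖ :=
    LinearIsometryEquiv.norm_map ContinuousLinearMap.adjoint _
  refine ⟨?_, ?_⟩
  · rw [hJB]
    refine (norm_mul_le _ _).trans ?_
    rwa [hnorm, ← sq]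
  have hdiag : ((Bᴴ * B) * (Bᴴ * B)).trace.re =
      ∑ i, ‖toEuclideanCLM (𝕜 := ℂ) (Bᴴ * B) (EuclideanSpace.single i 1)‖ ^ 2 := by
    simp_rw [norm_sq_apply_single, hJ.isHermitian.eq]
    simp only [trace, diag_apply, Complex.re_sum]
  rw [hdiag, ← htr, Finset.sum_mul]
  refine Finset.sum_le_sum fun i _ => ?_
  rw [← norm_sq_apply_single, hJB, mul_apply_eq_comp]
  set T := toEuclideanCLM (𝕜 := ℂ) B
  set e : EuclideanSpace ℂ (Fin d × Fin dq) := EuclideanSpace.single i 1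
  calc ‖star T (T e)‖ ^ 2 ≤ (‖star T‖ * ‖T e‖) ^ 2 := by
        gcongr; exact ContinuousLinearMap.le_opNorm _ _
    _ = ‖T e‖ ^ 2 * ‖T‖ ^ 2 := by rw [hnorm]; ring
    _ ≤ ‖T e‖ ^ 2 * dq := by gcongr
end

section
/- Let d ≥ d_q ≥ 1 and let A₁, …, A_K ∈ ℂ^{d_q×d} be Kraus operators of a mixedness-preserving quantum channel, i.e., ∑_{k=1}^K A_k† A_k = I_d and ∑_{k=1}^K A_k A_k† = (d/d_q)·I_{d_q}. Then ∑_{k=1}^K ∑_{l=1}^K |tr(A_k† A_l)|² ≤ d·d_q; equivalently, the Liouville matrix M_Φ of the channel Φ(X) = ∑_k A_k X A_k† satisfies ‖M_Φ‖₂ ≤ √(d·d_q). -/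
open Matrix

open scoped ComplexOrder in
/-- The trace form of the Kadison-Schwarz inequality for the unital completely positive map
`Y ↦ ∑ k, (A k)ᴴ * Y * A k`. -/
theorem trace_kadison_schwarz {ι m n : Type*} [Fintype ι] [Fintype m] [Fintype n] [DecidableEq n]
    (A : ι → Matrix m n ℂ) (hA : ∑ k, (A k)ᴴ * A k = 1) (Y : Matrix m m ℂ) :
    ((∑ k, (A k)ᴴ * Y * A k)ᴴ * ∑ k, (A k)ᴴ * Y * A k).trace ≤
      (Yᴴ * Y * ∑ k, A k * (A k)ᴴ).trace := by
  set Z := ∑ k, (A k)ᴴ * Y * A k with hZ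
  have hZH : Zᴴ = ∑ k, (A k)ᴴ * Yᴴ * A k := by
    simp [hZ, conjTranspose_sum, Matrix.mul_assoc]
  have hsum : ∑ k, (Y * A k - A k * Z)ᴴ * (Y * A k - A k * Z) =
      ∑ k, (A k)ᴴ * (Yᴴ * Y) * A k - Zᴴ * Z := by
    have hterm (k : ι) : (Y * A k - A k * Z)ᴴ * (Y * A k - A k * Z) =
        (A k)ᴴ * (Yᴴ * Y) * A k - (A k)ᴴ * Yᴴ * A k * Z - Zᴴ * ((A k)ᴴ * Y * A k)
          + Zᴴ * ((A k)ᴴ * A k) * Z := by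
      simp only [conjTranspose_sub, conjTranspose_mul, Matrix.sub_mul, Matrix.mul_sub,
        Matrix.mul_assoc]
      abel
    simp only [hterm, Finset.sum_add_distrib, Finset.sum_sub_distrib, ← Matrix.sum_mul,
      ← Matrix.mul_sum, hA, ← hZ, ← hZH, Matrix.mul_one]
    abel
  have htrace : (∑ k, (A k)ᴴ * (Yᴴ * Y) * A k).trace = (Yᴴ * Y * ∑ k, A k * (A k)ᴴ).trace := by
    simp only [Matrix.mul_sum, trace_sum]
    refine Finset.sum_congr rfl fun k _ => ?_
    rw [Matrix.mul_assoc, trace_mul_comm, Matrix.mul_assoc]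
  have hnonneg : 0 ≤ (∑ k, (Y * A k - A k * Z)ᴴ * (Y * A k - A k * Z)).trace := by
    rw [trace_sum]
    exact Finset.sum_nonneg fun k _ => (posSemidef_conjTranspose_mul_self _).trace_nonneg
  rwa [hsum, trace_sub, htrace, sub_nonneg] at hnonneg

/-- The squared Frobenius norm of the Liouville matrix, evaluated on the matrix units of the
output space. -/
theorem sum_norm_sq_trace_eq {ι m n : Type*} [Fintype ι] [Fintype m] [DecidableEq m] [Fintype n]
    (A : ι → Matrix m n ℂ) :
    ((∑ k, ∑ l, ‖((A k)ᴴ * A l).trace‖ ^ 2 : ℝ) : ℂ) =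
      ∑ i, ∑ j, ((∑ k, (A k)ᴴ * (single i j 1 : Matrix m m ℂ) * A k)ᴴ *
        ∑ k, (A k)ᴴ * (single i j 1 : Matrix m m ℂ) * A k).trace := by
  have hunit (i j : m) (k l : ι) :
      (((A k)ᴴ * (single i j 1 : Matrix m m ℂ) * A k)ᴴ * ((A l)ᴴ * (single i j 1 : Matrix m m ℂ) * A l)).trace =
        (A k * (A l)ᴴ) i i * (A l * (A k)ᴴ) j j := by
    have hcomm : (((A k)ᴴ * (single i j 1 : Matrix m m ℂ) * A k)ᴴ *
        ((A l)ᴴ * (single i j 1 : Matrix m m ℂ) * A l)).trace =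
        ((single j i 1 : Matrix m m ℂ) * (A k * (A l)ᴴ) * ((single i j 1 : Matrix m m ℂ) * (A l * (A k)ᴴ))).trace := by
      rw [conjTranspose_mul, conjTranspose_mul, conjTranspose_conjTranspose,
        conjTranspose_single, star_one, Matrix.mul_assoc, trace_mul_comm]
      simp only [Matrix.mul_assoc]
    rw [hcomm, ← Matrix.mul_assoc, single_mul_mul_single, trace_single_mul]
    simp
  simp only [conjTranspose_sum, Matrix.sum_mul, Matrix.mul_sum, trace_sum, hunit]
  have hnorm (k l : ι) : ((‖((A k)ᴴ * A l).trace‖ ^ 2 : ℝ) : ℂ) =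
      ∑ i, ∑ j, (A k * (A l)ᴴ) i i * (A l * (A k)ᴴ) j j := by
    have hstar : star ((A k)ᴴ * A l).trace = (A k * (A l)ᴴ).trace := by
      rw [← trace_conjTranspose, conjTranspose_mul, conjTranspose_conjTranspose, trace_mul_comm]
    rw [← Finset.sum_mul_sum, Complex.ofReal_pow, ← Complex.conj_mul', starRingEnd_apply, hstar,
      trace_mul_comm (A k)ᴴ]
    rfl
  push_cast at hnorm ⊢
  simp only [hnorm]
  rw [Finset.sum_comm, Finset.sum_comm_cycle]
  exact Finset.sum_congr rfl fun i _ => Finset.sum_comm_cycle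

/-- Frobenius-norm bound for the Liouville matrix of a mixedness-preserving channel:
if `A₁,…,A_K ∈ ℂ^{d_q×d}` satisfy `∑_k A_k† A_k = I_d` and `∑_k A_k A_k† = (d/d_q)·I_{d_q}`,
then `∑_{k,l} |tr(A_k† A_l)|² ≤ d·d_q` (this quantity being `‖M_Φ‖₂²`). -/
theorem stmt8 (d dq K : ℕ) (hdq : 1 ≤ dq) (hd : dq ≤ d)
    (A : Fin K → Matrix (Fin dq) (Fin d) ℂ)
    (htp : ∑ k, (A k)ᴴ * A k = 1)
    (hmix : ∑ k, A k * (A k)ᴴ = ((d : ℂ) / (dq : ℂ)) • 1) :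
    ∑ k, ∑ l, ‖((A k)ᴴ * A l).trace‖ ^ 2 ≤ (d : ℝ) * dq := by
  have hdq0 : (dq : ℂ) ≠ 0 := by
    exact_mod_cast (by omega : dq ≠ 0)
  open scoped ComplexOrder in
  rw [← Complex.real_le_real, sum_norm_sq_trace_eq]
  calc _ ≤ ∑ i : Fin dq, ∑ j : Fin dq, (d : ℂ) / dq := by
        refine Finset.sum_le_sum fun i _ => Finset.sum_le_sum fun j _ => ?_
        refine (trace_kadison_schwarz A htp _).trans_eq ?_
        simp [hmix]
    _ = ((d * dq : ℝ) : ℂ) := by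
        simp
        field_simp
end

section
/- Let d ≥ d_q ≥ 1 and let A₁, …, A_K ∈ ℂ^{d_q×d} be Kraus operators of a mixedness-preserving quantum channel, i.e., ∑_{k=1}^K A_k† A_k = I_d and ∑_{k=1}^K A_k A_k† = (d/d_q)·I_{d_q}. Then for every X ∈ ℂ^{d×d}, ‖∑_{k=1}^K A_k X A_k†‖₂ ≤ √(d/d_q) · ‖X‖₂; equivalently, the Liouville matrix M_Φ of the channel Φ(X) = ∑_k A_k X A_k† satisfies ‖M_Φ‖_∞ ≤ √(d/d_q). -/
open Matrix

/-- Frobenius (Schatten-2) norm of a complex matrix. -/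
noncomputable def frobNorm {m n : Type*} [Fintype m] [Fintype n] (M : Matrix m n ℂ) : ℝ :=
  Real.sqrt (∑ i, ∑ j, ‖M i j‖ ^ 2)

/-- The trace of `Mᴴ * M` is the sum of the squared moduli of the entries of `M`. -/
theorem trace_conjTranspose_mul_self_eq_sum {m n : Type*} [Fintype m] [Fintype n]
    (M : Matrix m n ℂ) :
    (Mᴴ * M).trace = ((∑ i, ∑ j, ‖M i j‖ ^ 2 : ℝ) : ℂ) := by
  simp only [Matrix.trace, Matrix.diag, Matrix.mul_apply, Matrix.conjTranspose_apply]
  rw [Finset.sum_comm]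
  push_cast
  refine Finset.sum_congr rfl fun i _ => Finset.sum_congr rfl fun j _ => ?_
  exact Complex.conj_mul' (M i j)

/-- Expansion of `∑ k, ‖(A k)ᴴ Y - c X (A k)ᴴ‖₂²` for `Y = ∑ k, A k * X * (A k)ᴴ`. -/
theorem sum_trace_kraus_sub {ι m n : Type*} [Fintype ι] [Fintype m] [Fintype n]
    [DecidableEq m] [DecidableEq n] (A : ι → Matrix m n ℂ) (c : ℝ)
    (htp : ∑ k, (A k)ᴴ * A k = 1) (hmix : ∑ k, A k * (A k)ᴴ = (c : ℂ) • 1)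
    (X : Matrix n n ℂ) (Y : Matrix m m ℂ) (hY : ∑ k, A k * X * (A k)ᴴ = Y) :
    ∑ k, (((A k)ᴴ * Y - (c : ℂ) • (X * (A k)ᴴ))ᴴ *
      ((A k)ᴴ * Y - (c : ℂ) • (X * (A k)ᴴ))).trace =
      (c : ℂ) ^ 2 * (Xᴴ * X).trace - c * (Yᴴ * Y).trace := by
  have hYY : ∑ k, (Yᴴ * (A k * (A k)ᴴ) * Y).trace = c * (Yᴴ * Y).trace := by
    rw [← Matrix.trace_sum, ← Finset.sum_mul, ← Finset.mul_sum, hmix]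
    simp
  have hXX : ∑ k, (Xᴴ * X * ((A k)ᴴ * A k)).trace = (Xᴴ * X).trace := by
    rw [← Matrix.trace_sum, ← Finset.mul_sum, htp, Matrix.mul_one]
  have hYX : ∑ k, (Yᴴ * (A k * X * (A k)ᴴ)).trace = (Yᴴ * Y).trace := by
    rw [← Matrix.trace_sum, ← Finset.mul_sum, hY]
  have hXY : ∑ k, ((A k * X * (A k)ᴴ)ᴴ * Y).trace = (Yᴴ * Y).trace := by
    rw [← Matrix.trace_sum, ← Finset.sum_mul, ← Matrix.conjTranspose_sum, hY]
  have hterm (k : ι) : (((A k)ᴴ * Y - (c : ℂ) • (X * (A k)ᴴ))ᴴ *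
      ((A k)ᴴ * Y - (c : ℂ) • (X * (A k)ᴴ))).trace =
      (Yᴴ * (A k * (A k)ᴴ) * Y).trace - c * (Yᴴ * (A k * X * (A k)ᴴ)).trace
        - c * ((A k * X * (A k)ᴴ)ᴴ * Y).trace
        + (c : ℂ) ^ 2 * (Xᴴ * X * ((A k)ᴴ * A k)).trace := by
    have hcyc : (Xᴴ * X * ((A k)ᴴ * A k)).trace = (A k * (Xᴴ * (X * (A k)ᴴ))).trace := by
      rw [← Matrix.mul_assoc, Matrix.trace_mul_comm, Matrix.mul_assoc Xᴴ]
    rw [hcyc]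
    simp only [Matrix.conjTranspose_sub, Matrix.conjTranspose_smul, Matrix.conjTranspose_mul,
      Matrix.conjTranspose_conjTranspose, Matrix.sub_mul, Matrix.mul_sub, Matrix.trace_sub,
      Matrix.smul_mul, Matrix.mul_smul, Matrix.trace_smul, smul_eq_mul, Matrix.mul_assoc,
      Complex.star_def, Complex.conj_ofReal]
    ring
  simp only [hterm, Finset.sum_add_distrib, Finset.sum_sub_distrib, ← Finset.mul_sum,
    hYY, hXX, hYX, hXY]
  ring

/-- Operator-norm bound for a mixedness-preserving channel: if `A₁,…,A_K ∈ ℂ^{d_q×d}` satisfy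
`∑_k A_k† A_k = I_d` and `∑_k A_k A_k† = (d/d_q)·I_{d_q}`, then for every `X ∈ ℂ^{d×d}`,
`‖∑_k A_k X A_k†‖₂ ≤ √(d/d_q)·‖X‖₂`, i.e. `‖M_Φ‖_∞ ≤ √(d/d_q)`. -/
theorem stmt9 (d dq K : ℕ) (hdq : 1 ≤ dq) (hd : dq ≤ d)
    (A : Fin K → Matrix (Fin dq) (Fin d) ℂ)
    (htp : ∑ k, (A k)ᴴ * A k = 1)
    (hmix : ∑ k, A k * (A k)ᴴ = ((d : ℂ) / (dq : ℂ)) • 1)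
    (X : Matrix (Fin d) (Fin d) ℂ) :
    frobNorm (∑ k, A k * X * (A k)ᴴ) ≤ Real.sqrt ((d : ℝ) / dq) * frobNorm X := by
  set Y := ∑ k, A k * X * (A k)ᴴ with hY
  have hc : (0 : ℝ) < (d : ℝ) / dq := by
    have : 0 < dq := hdq
    have : 0 < d := hdq.trans hd
    positivity
  have key := sum_trace_kraus_sub A ((d : ℝ) / dq) htp (by rw [hmix]; push_cast; rfl) X Y hY.symm
  simp only [trace_conjTranspose_mul_self_eq_sum] at key
  norm_cast at key
  unfold frobNorm
  rw [← Real.sqrt_mul hc.le]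
  refine Real.sqrt_le_sqrt (le_of_mul_le_mul_left ?_ hc)
  rw [← mul_assoc, ← sq, ← sub_nonneg]
  refine le_of_le_of_eq ?_ key
  positivity
end
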